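/- For all integers m, n, t with m, n, t ≤ -1 and not all three equal to -1, and any solution (a, b, c) of the Q(m,n,t)-system in nonzero real numbers, there is no invertible diagonal 3×3 real matrix D such that D * A(a,b,c) is symmetric; that is, the Cartan matrix of Q^±(m,n,t) is not symmetrizable. -/

import Mathlib

/-- A triple `(a, b, c)` of nonzero real numbers is a solution of the `Q(m,n,t)`-system
if `1 + a + 1/b = m`, `1 + b + 1/c = n` and `1 + c + 1/a = t`. -/
def QSystem (m n t : ℤ) (a b c : ℝ) : Prop :=
  a ≠ 0 ∧ b ≠ 0 ∧ c ≠ 0 ∧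
  1 + a + 1 / b = (m : ℝ) ∧ 1 + b + 1 / c = (n : ℝ) ∧ 1 + c + 1 / a = (t : ℝ)

/-- The Cartan matrix of the Dynkin diagram `Q^±(m,n,t)`. -/
def CartanQ (a b c : ℝ) : Matrix (Fin 3) (Fin 3) ℝ :=
  !![0, 1, a; b, 0, 1; 1, c, 0]

/-- A `Q(m,n,t)`-system with `m`, `n` and `t` negative has no solution with `a * b * c = 1`. -/
theorem QSystem.mul_ne_one {m n t : ℤ} {a b c : ℝ} (h : QSystem m n t a b c)
    (hm : m < 0) (hn : n < 0) (ht : t < 0) : a * b * c ≠ 1 := by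
  obtain ⟨ha, hb, hc, h₁, h₂, h₃⟩ := h
  intro habc
  have hm' : (m : ℝ) < 0 := by exact_mod_cast hm
  have hn' : (n : ℝ) < 0 := by exact_mod_cast hn
  have ht' : (t : ℝ) < 0 := by exact_mod_cast ht
  have hb_inv : 1 / b = a * c := by
    rw [div_eq_iff hb]
    linear_combination -habc
  have hc_inv : 1 / c = a * b := by
    rw [div_eq_iff hc]
    linear_combination -habc
  have ha_inv : 1 / a = b * c := by
    rw [div_eq_iff ha]
    linear_combination -habc
  rw [hb_inv] at h₁
  rw [hc_inv] at h₂
  rw [ha_inv] at h₃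
  have hat : a * t = m := by linear_combination h₁ - a * h₃ + habc
  have hcn : c * n = t := by linear_combination h₃ - c * h₂ + habc
  have ha_pos : 0 < a := pos_of_mul_neg_left (hat ▸ hm') ht'.le
  have hc_pos : 0 < c := pos_of_mul_neg_left (hcn ▸ ht') hn'.le
  have : 0 < a * c := mul_pos ha_pos hc_pos
  linarith

/-- If the Cartan matrix of `Q^±(m,n,t)` is symmetrizable, then `a * b * c = 1`. -/
theorem mul_eq_one_of_isSymm_mul_CartanQ {a b c : ℝ} {D : Matrix (Fin 3) (Fin 3) ℝ}
    (hD : D.IsDiag) (hu : IsUnit D) (hs : (D * CartanQ a b c).IsSymm) : a * b * c = 1 := by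
  obtain ⟨d, rfl⟩ : ∃ d, D = Matrix.diagonal d := ⟨D.diag, hD.diagonal_diag.symm⟩
  have hd : d 0 ≠ 0 := (Pi.isUnit_iff.mp (Matrix.isUnit_diagonal.mp hu) 0).ne_zero
  have h₁ := hs.apply 0 1
  have h₂ := hs.apply 0 2
  have h₃ := hs.apply 1 2
  simp [CartanQ, Matrix.diagonal_mul] at h₁ h₂ h₃
  apply mul_left_cancel₀ hd
  linear_combination h₁ - b * c * h₂ + b * h₃

/-- For integers `m, n, t ≤ -1`, not all equal to `-1`, and any solution `(a,b,c)` of the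
`Q(m,n,t)`-system, the Cartan matrix of `Q^±(m,n,t)` is not symmetrizable: there is no
invertible diagonal real matrix `D` with `D * A(a,b,c)` symmetric. -/
theorem CartanQ_not_symmetrizable (m n t : ℤ) (hm : m ≤ -1) (hn : n ≤ -1) (ht : t ≤ -1)
    (hne : ¬(m = -1 ∧ n = -1 ∧ t = -1)) (a b c : ℝ) (h : QSystem m n t a b c) :
    ¬ ∃ D : Matrix (Fin 3) (Fin 3) ℝ, D.IsDiag ∧ IsUnit D ∧ (D * CartanQ a b c).IsSymm := by
  rintro ⟨D, hD, hu, hs⟩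
  exact h.mul_ne_one (by lia) (by lia) (by lia) (mul_eq_one_of_isSymm_mul_CartanQ hD hu hs)
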